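/- Assume ω is alternating. Let (V_0,…,V_{k−1}) and (V′_0,…,V′_{k−1}) be two isotropic partial flags of the same type d in V. Then there exists a linear automorphism g of V with ω(g(v), g(w)) = ω(v,w) for all v,w ∈ V such that g(V_p) = V′_p for all p = 0,…,k−1. In other words, the symplectic group Sp(V,ω) acts transitively on the set of isotropic partial flags of type d. -/

import Mathlib

open Module Submodule

theorem aux_transv {V : Type*} [AddCommGroup V] [Module ℂ V]
    (ω : V →ₗ[ℂ] V →ₗ[ℂ] ℂ) (halt : ∀ v, ω v v = 0) (a : V) (c : ℂ) :
    ∃ g : V ≃ₗ[ℂ] V, (∀ v w, ω (g v) (g w) = ω v w) ∧ ∀ v, g v = v + (c * ω v a) • a := by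
  have hsk : ∀ v w, ω v w = - ω w v := by
    intro v w
    have h := halt (v + w)
    simp only [map_add, LinearMap.add_apply, halt] at h
    linear_combination h
  let T : ℂ → V →ₗ[ℂ] V := fun c => LinearMap.id + c • (ω.flip a).smulRight a
  have hT : ∀ c v, T c v = v + (c * ω v a) • a := by
    intro c v
    simp [T, smul_smul]
  have hc : ∀ c v, T c (T (-c) v) = v := by
    intro c v
    rw [hT, hT]
    simp only [map_add, LinearMap.add_apply, map_smul, LinearMap.smul_apply, halt]
    module
  refine ⟨LinearEquiv.ofLinear (T c) (T (-c)) ?_ ?_, ?_, ?_⟩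
  · ext v; exact hc c v
  · ext v; simpa using hc (-c) v
  · intro v w
    simp only [LinearEquiv.ofLinear_apply, hT, map_add, LinearMap.add_apply, map_smul,
      LinearMap.smul_apply, halt, smul_eq_mul]
    rw [hsk a w]
    ring
  · intro v
    simp [hT]

theorem aux_sep {V : Type*} [AddCommGroup V] [Module ℂ V] [FiniteDimensional ℂ V]
    (ω : V →ₗ[ℂ] V →ₗ[ℂ] ℂ) (hnd : ∀ v, (∀ w, ω v w = 0) → v = 0)
    (W : Submodule ℂ V) (u : V) (hu : u ∉ W) :
    ∃ y, (∀ w ∈ W, ω y w = 0) ∧ ω y u ≠ 0 := by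
  obtain ⟨φ, h1, h2⟩ := Submodule.exists_le_ker_of_notMem hu
  have hinj : Function.Injective ω := by
    rw [injective_iff_map_eq_zero]
    intro v hv
    exact hnd v (fun w => by rw [hv]; rfl)
  have hs : Function.Surjective ω :=
    (LinearMap.injective_iff_surjective_of_finrank_eq_finrank
      (Subspace.dual_finrank_eq (K := ℂ) (V := V)).symm).1 hinj
  obtain ⟨y, rfl⟩ := hs φ
  exact ⟨y, fun w hw => h2 hw, h1⟩

theorem aux_step {V : Type*} [AddCommGroup V] [Module ℂ V] [FiniteDimensional ℂ V]
    (ω : V →ₗ[ℂ] V →ₗ[ℂ] ℂ) (hnd : ∀ v, (∀ w, ω v w = 0) → v = 0)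
    (halt : ∀ v, ω v v = 0)
    (W : Submodule ℂ V) (u u' : V) (hu : u ∉ W) (hu' : u' ∉ W)
    (ho : ∀ w ∈ W, ω w u = 0) (ho' : ∀ w ∈ W, ω w u' = 0) :
    ∃ g : V ≃ₗ[ℂ] V, (∀ v w, ω (g v) (g w) = ω v w) ∧ (∀ w ∈ W, g w = w) ∧ g u = u' := by
  have hsk : ∀ v w, ω v w = - ω w v := by
    intro v w
    have h := halt (v + w)
    simp only [map_add, LinearMap.add_apply, halt] at h
    linear_combination h
  have key : ∀ u u', (∀ w ∈ W, ω w u = 0) → (∀ w ∈ W, ω w u' = 0) → ω u u' ≠ 0 →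
      ∃ g : V ≃ₗ[ℂ] V, (∀ v w, ω (g v) (g w) = ω v w) ∧ (∀ w ∈ W, g w = w) ∧ g u = u' := by
    intro u u' ho ho' hne
    obtain ⟨g, hg, hgv⟩ := aux_transv ω halt (u' - u) (ω u u')⁻¹
    refine ⟨g, hg, ?_, ?_⟩
    · intro w hw
      simp [hgv, ho w hw, ho' w hw]
    · rw [hgv]
      simp [halt, hne]
  obtain ⟨y, hy, hyu⟩ := aux_sep ω hnd W u hu
  obtain ⟨z, hz, hzu⟩ := aux_sep ω hnd W u' hu'
  have : ∃ x, (∀ w ∈ W, ω x w = 0) ∧ ω x u ≠ 0 ∧ ω x u' ≠ 0 := by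
    by_cases h1 : ω y u' = 0
    · by_cases h2 : ω z u = 0
      · refine ⟨y + z, fun w hw => by simp [hy w hw, hz w hw], ?_, ?_⟩
        · simpa [h2] using hyu
        · simpa [h1] using hzu
      · exact ⟨z, hz, h2, hzu⟩
    · exact ⟨y, hy, hyu, h1⟩
  obtain ⟨x, hx, h1, h2⟩ := this
  have hx' : ∀ w ∈ W, ω w x = 0 := fun w hw => by rw [hsk, hx w hw, neg_zero]
  obtain ⟨g, hg, hgW, hgu⟩ := key u x ho hx' (by rw [hsk]; exact neg_ne_zero.2 h1)
  obtain ⟨g', hg', hgW', hgu'⟩ := key x u' hx' ho' h2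
  refine ⟨g.trans g', ?_, ?_, ?_⟩
  · intro v w; simp [hg, hg']
  · intro w hw; simp [hgW w hw, hgW' w hw]
  · simp [hgu, hgu']

theorem aux_ext {V : Type*} [AddCommGroup V] [Module ℂ V] [FiniteDimensional ℂ V]
    (ω : V →ₗ[ℂ] V →ₗ[ℂ] ℂ) (hnd : ∀ v, (∀ w, ω v w = 0) → v = 0)
    (halt : ∀ v, ω v v = 0) (n : ℕ) :
    ∀ (W A A' : Submodule ℂ V), W ≤ A → W ≤ A' →
    (∀ v ∈ A, ∀ w ∈ A, ω v w = 0) → (∀ v ∈ A', ∀ w ∈ A', ω v w = 0) →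
    finrank ℂ A = finrank ℂ A' → finrank ℂ A ≤ finrank ℂ W + n →
    ∃ g : V ≃ₗ[ℂ] V, (∀ v w, ω (g v) (g w) = ω v w) ∧ (∀ w ∈ W, g w = w) ∧
      A.map (g : V →ₗ[ℂ] V) = A' := by
  induction n with
  | zero =>
    intro W A A' h h' _ _ he hn
    have e1 := Submodule.eq_of_le_of_finrank_le h hn
    have e2 := Submodule.eq_of_le_of_finrank_le h' (he ▸ hn)
    refine ⟨LinearEquiv.refl ℂ V, by simp, by simp, ?_⟩
    rw [← e1, ← e2]
    ext; simp
  | succ n ih =>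
    intro W A A' h h' hi hi' he hn
    by_cases hle : finrank ℂ A ≤ finrank ℂ W + n
    · exact ih W A A' h h' hi hi' he hle
    have hA : ¬ A ≤ W := fun hc => by
      have := Submodule.finrank_mono hc
      omega
    have hA' : ¬ A' ≤ W := fun hc => by
      have := Submodule.finrank_mono hc
      omega
    obtain ⟨u, huA, hu⟩ := SetLike.not_le_iff_exists.1 hA
    obtain ⟨u', huA', hu'⟩ := SetLike.not_le_iff_exists.1 hA'
    obtain ⟨g, hg, hgW, hgu⟩ := aux_step ω hnd halt W u u' hu hu'
      (fun w hw => hi w (h hw) u huA) (fun w hw => hi' w (h' hw) u' huA')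
    have hfr : finrank ℂ (A.map (g : V →ₗ[ℂ] V)) = finrank ℂ A := LinearEquiv.finrank_map_eq g A
    have hlt : W < W ⊔ span ℂ {u'} := by
      refine lt_of_le_of_ne le_sup_left fun hc => hu' ?_
      rw [hc]
      exact (le_sup_right : span ℂ {u'} ≤ _) (mem_span_singleton_self u')
    have hlt' := Submodule.finrank_lt_finrank_of_lt hlt
    obtain ⟨g', hg', hgW', hgA⟩ := ih (W ⊔ span ℂ {u'}) (A.map (g : V →ₗ[ℂ] V)) A'
      (by
        refine sup_le (fun w hw => ⟨w, h hw, hgW w hw⟩) ?_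
        rw [span_singleton_le_iff_mem]
        exact ⟨u, huA, hgu⟩)
      (by
        refine sup_le h' ?_
        rwa [span_singleton_le_iff_mem])
      (by
        rintro _ ⟨v, hv, rfl⟩ _ ⟨w, hw, rfl⟩
        exact (hg v w).trans (hi v hv w hw))
      hi' (hfr.trans he) (by omega)
    refine ⟨g.trans g', ?_, ?_, ?_⟩
    · intro v w; simp [hg, hg']
    · intro w hw
      simp [hgW w hw, hgW' w (le_sup_left (a := W) hw)]
    · rw [← hgA, ← Submodule.map_comp]; rfl



/-- The symplectic group `Sp(V,ω)` acts transitively on the set of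
isotropic partial flags of a given type `d`. -/
theorem stmt_3 (V : Type*) [AddCommGroup V] [Module ℂ V] [FiniteDimensional ℂ V]
    (m : ℕ) (hdimV : finrank ℂ V = m)
    (ω : V →ₗ[ℂ] V →ₗ[ℂ] ℂ)
    (hnd : ∀ v, (∀ w, ω v w = 0) → v = 0)
    (halt : ∀ v, ω v v = 0)
    (k : ℕ) (hk : 2 ≤ k)
    (d : Fin k → ℕ) (hd0 : d ⟨0, by omega⟩ = 0) (hdsm : StrictMono d)
    (hdm : 2 * d ⟨k - 1, by omega⟩ ≤ m)
    (F F' : Fin k → Submodule ℂ V)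
    (hFmono : Monotone F) (hF'mono : Monotone F')
    (hFiso : ∀ p, ∀ v ∈ F p, ∀ w ∈ F p, ω v w = 0)
    (hF'iso : ∀ p, ∀ v ∈ F' p, ∀ w ∈ F' p, ω v w = 0)
    (hFdim : ∀ p, finrank ℂ (F p) = d p) (hF'dim : ∀ p, finrank ℂ (F' p) = d p) :
    ∃ g : V ≃ₗ[ℂ] V, (∀ v w, ω (g v) (g w) = ω v w) ∧
      ∀ p, (F p).map (g : V →ₗ[ℂ] V) = F' p := by
  have main : ∀ n (hn : n < k), ∃ g : V ≃ₗ[ℂ] V, (∀ v w, ω (g v) (g w) = ω v w) ∧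
      ∀ p : Fin k, p.1 ≤ n → (F p).map (g : V →ₗ[ℂ] V) = F' p := by
    intro n
    induction n with
    | zero =>
      intro hn
      obtain ⟨g, hg, _, hA⟩ := aux_ext ω hnd halt (finrank ℂ (F ⟨0, hn⟩)) ⊥ (F ⟨0, hn⟩) (F' ⟨0, hn⟩)
        bot_le bot_le (hFiso _) (hF'iso _) (by rw [hFdim, hF'dim]) (by omega)
      refine ⟨g, hg, fun p hp => ?_⟩
      obtain rfl : p = ⟨0, hn⟩ := Fin.ext (by simpa using hp)
      exact hA
    | succ n ih =>
      intro hn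
      obtain ⟨g, hg, hgF⟩ := ih (by omega)
      have hn' : n < k := by omega
      have hfr : finrank ℂ ((F ⟨n+1, hn⟩).map (g : V →ₗ[ℂ] V)) = finrank ℂ (F ⟨n+1, hn⟩) :=
        LinearEquiv.finrank_map_eq g _
      have hle : (⟨n, hn'⟩ : Fin k) ≤ ⟨n+1, hn⟩ := by simp [Fin.le_def]
      obtain ⟨g', hg', hW, hA⟩ := aux_ext ω hnd halt (finrank ℂ (F ⟨n+1, hn⟩)) (F' ⟨n, hn'⟩)
        ((F ⟨n+1, hn⟩).map (g : V →ₗ[ℂ] V)) (F' ⟨n+1, hn⟩)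
        (by rw [← hgF ⟨n, hn'⟩ le_rfl]; exact Submodule.map_mono (hFmono hle))
        (hF'mono hle)
        (by
          rintro _ ⟨v, hv, rfl⟩ _ ⟨w, hw, rfl⟩
          exact (hg v w).trans (hFiso _ v hv w hw))
        (hF'iso _) (by rw [hfr, hFdim, hF'dim]) (by omega)
      refine ⟨g.trans g', fun v w => by simp [hg, hg'], fun p hp => ?_⟩
      have hcomp : (F p).map ((g.trans g' : V ≃ₗ[ℂ] V) : V →ₗ[ℂ] V) =
          ((F p).map (g : V →ₗ[ℂ] V)).map (g' : V →ₗ[ℂ] V) := by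
        rw [← Submodule.map_comp]; rfl
      rw [hcomp]
      rcases Nat.lt_or_ge n p.1 with h | h
      · obtain rfl : p = ⟨n+1, hn⟩ := Fin.ext (by simp; omega)
        exact hA
      · rw [hgF p h]
        have hpW : F' p ≤ F' ⟨n, hn'⟩ := hF'mono (by simpa [Fin.le_def] using h)
        ext x
        constructor
        · rintro ⟨y, hy, rfl⟩
          have := hW y (hpW hy)
          simpa [this] using hy
        · intro hx
          exact ⟨x, hx, hW x (hpW hx)⟩
  obtain ⟨g, hg, h⟩ := main (k - 1) (by omega)
  exact ⟨g, hg, fun p => h p (by have := p.2; omega)⟩
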